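/- The quasi-modular forms ℰ₄ := (𝒞₄⁴)′/𝒞₄⁴, ℰ₃ := (𝒞₃³)′/𝒞₃³ and ℰ₂ := (θ₂⁴)′/θ₂⁴ have the following Eisenstein and weighted-divisor-function representations: ℰ₄(τ) = (1/3)[4E₂(q²) − E₂(q)] = 1 + 8∑_{n≥1} σ₁(n; −1,1) qⁿ = 1 + 8∑_{n≥1} σᶜ₁(n; −3,1) qⁿ; ℰ₃(τ) = (1/8)[9E₂(q³) − E₂(q)] = 1 + 3∑_{n≥1} σ₁(n; −2,1,1) qⁿ = 1 + 3∑_{n≥1} σᶜ₁(n; −8,1,1) qⁿ; ℰ₂(τ) = (1/3)[4E₂(q⁴) − E₂(q²)] = 1 + 4∑_{n≥1} σ₁(n; −1,0,1,0) qⁿ = 1 + 8∑_{n≥1} σᶜ₁(n; −3,0,1,0) qⁿ; moreover ℰ₂(τ) = ℰ₄(2τ) for all τ in the upper half-plane. -/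

import Mathlib

open Complex

noncomputable section

/-- q = exp(2πiτ). -/
def qq (τ : ℂ) : ℂ := Complex.exp (2 * Real.pi * Complex.I * τ)

/-- The Dedekind eta function η(τ) = exp(πiτ/12)·∏_{n≥1} (1 − qⁿ). -/
def dedekindEta (τ : ℂ) : ℂ :=
  Complex.exp (Real.pi * Complex.I * τ / 12) * ∏' n : ℕ, (1 - qq τ ^ (n + 1))

/-- The Jacobi theta-null θ₂. -/
def theta2 (τ : ℂ) : ℂ :=
  ∑' m : ℤ, Complex.exp (2 * Real.pi * Complex.I * τ * ((m : ℂ) + 1 / 2) ^ 2)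

/-- 𝒞₃(τ) = 3·η(3τ)³/η(τ). -/
def C3 (τ : ℂ) : ℂ := 3 * dedekindEta (3 * τ) ^ 3 / dedekindEta τ

/-- 𝒞₄⁴(τ) = 64·η(2τ)¹⁶/η(τ)⁸. -/
def C44 (τ : ℂ) : ℂ := 64 * dedekindEta (2 * τ) ^ 16 / dedekindEta τ ^ 8

/-- The derivation f ↦ f′ = (2πi)⁻¹ df/dτ = q d/dq. -/
def dq (f : ℂ → ℂ) : ℂ → ℂ := fun τ => (2 * Real.pi * Complex.I)⁻¹ * deriv f τ

/-- ℰ₄ := (𝒞₄⁴)′/𝒞₄⁴. -/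
def E4sig : ℂ → ℂ := fun τ => dq C44 τ / C44 τ

/-- ℰ₃ := (𝒞₃³)′/𝒞₃³. -/
def E3sig : ℂ → ℂ := fun τ => dq (fun t => C3 t ^ 3) τ / C3 τ ^ 3

/-- ℰ₂ := (θ₂⁴)′/θ₂⁴. -/
def E2sig : ℂ → ℂ := fun τ => dq (fun t => theta2 t ^ 4) τ / theta2 τ ^ 4

/-- The quasi-modular Eisenstein series E₂ as a function of its argument q:
E₂(x) = 1 − 24 ∑_{n≥1} σ₁(n) xⁿ. -/
def EisE2 (x : ℂ) : ℂ := 1 - 24 * ∑' n : ℕ, (∑ d ∈ (n + 1).divisors, (d : ℂ)) * x ^ (n + 1)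

/-- The χ-weighted divisor function σ_k(n; χ) = ∑_{d∣n} χ(d mod N) d^k,
where χ is given by its values on residues mod N. -/
def wdiv (k N : ℕ) (χ : ℕ → ℂ) (n : ℕ) : ℂ := ∑ d ∈ n.divisors, χ (d % N) * (d : ℂ) ^ k

/-- The χ-weighted conjugate divisor function σᶜ_k(n; χ) = ∑_{d∣n} χ((n/d) mod N) d^k. -/
def wdivc (k N : ℕ) (χ : ℕ → ℂ) (n : ℕ) : ℂ := ∑ d ∈ n.divisors, χ ((n / d) % N) * (d : ℂ) ^ k

/-! ### Gauss' triangular number identity -/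

/-- partial Gauss product -/
def gP (x : ℂ) (n : ℕ) : ℂ := ∏ i ∈ Finset.range n, (1 - x ^ (2 * i + 2)) / (1 - x ^ (2 * i + 1))

lemma one_sub_pow_ne {x : ℂ} (hx : ‖x‖ < 1) (n : ℕ) : 1 - x ^ (n + 1) ≠ 0 := by
  intro h
  have h1 : x ^ (n + 1) = 1 := (sub_eq_zero.mp h).symm
  have h2 : ‖x‖ ^ (n + 1) = 1 := by rw [← norm_pow, h1, norm_one]
  have h3 : ‖x‖ ^ (n + 1) < 1 := pow_lt_one₀ (norm_nonneg _) hx (by omega)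
  linarith

lemma gP_ne {x : ℂ} (hx : ‖x‖ < 1) (n : ℕ) : gP x n ≠ 0 := by
  unfold gP
  refine Finset.prod_ne_zero_iff.mpr fun i _ => ?_
  exact div_ne_zero (one_sub_pow_ne hx (2 * i + 1)) (one_sub_pow_ne hx (2 * i))

lemma gP_succ (x : ℂ) (n : ℕ) :
    gP x (n + 1) = gP x n * ((1 - x ^ (2 * n + 2)) / (1 - x ^ (2 * n + 1))) := by
  rw [gP, Finset.prod_range_succ, ← gP]

lemma gauss_aux {x : ℂ} (hx : ‖x‖ < 1) (n k : ℕ) :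
    ∑ s ∈ Finset.range k, (gP x (n + 1) / gP x s * x ^ (s * (2 * n + 3))
      - gP x n / gP x s * x ^ (s * (2 * n + 1))) =
    gP x n / (1 - x ^ (2 * n + 1)) * ((1 - x ^ (2 * k)) * x ^ (k * (2 * n + 1)) / gP x k) := by
  induction k with
  | zero => simp
  | succ k ih =>
    rw [Finset.sum_range_succ, ih, gP_succ x n, gP_succ x k]
    have h1 := one_sub_pow_ne hx (2 * n)
    have h2 := one_sub_pow_ne hx (2 * k)
    have h3 : 1 - x ^ (2 * k + 2) ≠ 0 := one_sub_pow_ne hx (2 * k + 1)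
    have h4 := gP_ne hx k
    have h5 : 1 - x ^ (2 * (k + 1)) = 1 - x ^ (2 * k + 2) := by ring
    rw [h5]
    have e1 : x ^ (k * (2 * n + 3)) = x ^ (k * (2 * n + 1)) * x ^ (2 * k) := by ring
    have e2 : x ^ ((k + 1) * (2 * n + 1)) = x ^ (k * (2 * n + 1)) * x ^ (2 * n + 1) := by ring
    have e3 : x ^ (2 * n + 2) = x ^ (2 * n + 1) * x := by ring
    have e4 : x ^ (2 * k + 1) = x ^ (2 * k) * x := by ring
    rw [e1, e2, e3]
    generalize x ^ (k * (2 * n + 1)) = A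
    rw [e4] at *
    generalize 1 - x ^ (2 * k + 2) = D at *
    generalize x ^ (2 * k) = B at *
    generalize x ^ (2 * n + 1) = C at *
    field_simp
    ring

lemma gauss_finite {x : ℂ} (hx : ‖x‖ < 1) (n : ℕ) :
    ∑ s ∈ Finset.range n, gP x n / gP x s * x ^ (s * (2 * n + 1)) =
    ∑ s ∈ Finset.range (2 * n), x ^ (s * (s + 1) / 2) := by
  induction n with
  | zero => simp
  | succ n ih =>
    have h := gauss_aux hx n (n + 1)
    rw [Finset.sum_sub_distrib, sub_eq_iff_eq_add] at h
    have e : 2 * (n + 1) + 1 = 2 * n + 3 := by ring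
    rw [e, h, Finset.sum_range_succ _ n, ih, show 2 * (n + 1) = 2 * n + 1 + 1 by ring,
      Finset.sum_range_succ, Finset.sum_range_succ,
      show 2 * n * (2 * n + 1) / 2 = n * (2 * n + 1) by
        rw [show 2 * n * (2 * n + 1) = 2 * (n * (2 * n + 1)) by ring]; simp,
      show (2 * n + 1) * (2 * n + 1 + 1) / 2 = (n + 1) * (2 * n + 1) by
        rw [show (2 * n + 1) * (2 * n + 1 + 1) = 2 * ((n + 1) * (2 * n + 1)) by ring]; simp,
      gP_succ]
    have h1 := one_sub_pow_ne hx (2 * n)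
    have h3 : 1 - x ^ (2 * n + 2) ≠ 0 := one_sub_pow_ne hx (2 * n + 1)
    have h4 := gP_ne hx n
    rw [show 2 * n + 1 + 1 = 2 * n + 2 by ring]
    generalize x ^ ((n + 1) * (2 * n + 1)) = A
    field_simp
    ring

/-- the Euler product -/
def eul (x : ℂ) : ℂ := ∏' n : ℕ, (1 - x ^ (n + 1))

lemma eul_ne {x : ℂ} (hx : ‖x‖ < 1) : eul x ≠ 0 := by
  unfold eul
  have := tprod_one_add_ne_zero_of_summable (f := fun n : ℕ => -x ^ (n + 1))
    (fun i => by simpa [sub_eq_add_neg] using one_sub_pow_ne hx i)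
    (by simpa using (summable_nat_add_iff 1).mpr (summable_geometric_of_lt_one (norm_nonneg _) hx))
  simpa [sub_eq_add_neg] using this

lemma gP_eq {x : ℂ} (hx : ‖x‖ < 1) (n : ℕ) :
    gP x n = (∏ i ∈ Finset.range n, (1 - (x ^ 2) ^ (i + 1))) ^ 2 /
      ∏ i ∈ Finset.range (2 * n), (1 - x ^ (i + 1)) := by
  induction n with
  | zero => simp [gP]
  | succ n ih =>
    have h1 := one_sub_pow_ne hx (2 * n)
    have h3 : 1 - x ^ (2 * n + 2) ≠ 0 := one_sub_pow_ne hx (2 * n + 1)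
    have h4 : ∏ i ∈ Finset.range (2 * n), (1 - x ^ (i + 1)) ≠ 0 :=
      Finset.prod_ne_zero_iff.mpr fun i _ => one_sub_pow_ne hx i
    rw [gP_succ, ih, show 2 * (n + 1) = 2 * n + 1 + 1 by ring, Finset.prod_range_succ,
      Finset.prod_range_succ, Finset.prod_range_succ, show 2 * n + 1 + 1 = 2 * n + 2 by ring,
      show (x ^ 2) ^ (n + 1) = x ^ (2 * n + 2) by ring]
    field_simp

lemma norm_sq_lt {x : ℂ} (hx : ‖x‖ < 1) {k : ℕ} (hk : k ≠ 0) : ‖x ^ k‖ < 1 := by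
  rw [norm_pow]; exact pow_lt_one₀ (norm_nonneg _) hx hk

lemma gP_tendsto {x : ℂ} (hx : ‖x‖ < 1) :
    Filter.Tendsto (gP x) Filter.atTop (nhds (eul (x ^ 2) ^ 2 / eul x)) := by
  have a := (ModularForm.multipliable_one_sub_pow
    (norm_sq_lt hx (k := 2) (by norm_num))).hasProd.tendsto_prod_nat
  have b := (ModularForm.multipliable_one_sub_pow hx).hasProd.tendsto_prod_nat
  have b' := b.comp (Filter.tendsto_id.const_mul_atTop' (show 0 < 2 by norm_num))
  have := (a.pow 2).div b' (eul_ne hx)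
  exact this.congr fun n => (gP_eq hx n).symm

lemma tri_summable {x : ℂ} (hx : ‖x‖ < 1) : Summable fun s : ℕ => x ^ (s * (s + 1) / 2) := by
  refine Summable.of_norm_bounded (g := fun s : ℕ => ‖x‖ ^ s)
    (summable_geometric_of_lt_one (norm_nonneg _) hx) fun s => ?_
  rw [norm_pow]
  refine pow_le_pow_of_le_one (norm_nonneg _) hx.le ?_
  rw [Nat.le_div_iff_mul_le (by norm_num)]
  rcases s with _ | s
  · simp
  · nlinarith

lemma gauss_identity {x : ℂ} (hx : ‖x‖ < 1) :
    ∑' s : ℕ, x ^ (s * (s + 1) / 2) = eul (x ^ 2) ^ 2 / eul x := by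
  have hP := gP_tendsto hx
  have hne : eul (x ^ 2) ^ 2 / eul x ≠ 0 :=
    div_ne_zero (pow_ne_zero _ (eul_ne (norm_sq_lt hx (by norm_num)))) (eul_ne hx)
  have hPi := hP.inv₀ hne
  obtain ⟨A, hA⟩ := hP.norm.bddAbove_range
  obtain ⟨B, hB⟩ := hPi.norm.bddAbove_range
  have hA' : ∀ n, ‖gP x n‖ ≤ A := fun n => hA ⟨n, rfl⟩
  have hB' : ∀ n, ‖(gP x n)⁻¹‖ ≤ B := fun n => hB ⟨n, rfl⟩
  have hA0 : 0 ≤ A := (norm_nonneg _).trans (hA' 0)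
  have hB0 : 0 ≤ B := (norm_nonneg _).trans (hB' 0)
  have h1 : Filter.Tendsto (fun n => ∑ s ∈ Finset.range (2 * n), x ^ (s * (s + 1) / 2))
      Filter.atTop (nhds (∑' s : ℕ, x ^ (s * (s + 1) / 2))) :=
    (tri_summable hx).hasSum.tendsto_sum_nat.comp
      (Filter.tendsto_id.const_mul_atTop' (show 0 < 2 by norm_num))
  refine tendsto_nhds_unique h1 ?_
  simp_rw [← gauss_finite hx]
  rw [← Filter.tendsto_add_atTop_iff_nat 1]
  have h2 : ∀ n : ℕ, ∑ s ∈ Finset.range (n + 1),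
      gP x (n + 1) / gP x s * x ^ (s * (2 * (n + 1) + 1)) =
      (∑ s ∈ Finset.range n, gP x (n + 1) / gP x (s + 1) * x ^ ((s + 1) * (2 * (n + 1) + 1)))
       + gP x (n + 1) := by
    intro n
    rw [Finset.sum_range_succ']
    simp [gP]
  simp_rw [h2]
  rw [← zero_add (eul (x ^ 2) ^ 2 / eul x)]
  refine Filter.Tendsto.add ?_ (hP.comp (Filter.tendsto_add_atTop_nat 1))
  have hg := summable_geometric_of_lt_one (norm_nonneg _) hx
  have hlim : Filter.Tendsto (fun n : ℕ => A * B * ‖x‖ ^ n * ∑' s : ℕ, ‖x‖ ^ s)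
      Filter.atTop (nhds 0) := by
    have := ((tendsto_pow_atTop_nhds_zero_of_lt_one (norm_nonneg x) hx).const_mul
      (A * B)).mul_const (∑' s : ℕ, ‖x‖ ^ s)
    simpa using this
  refine squeeze_zero_norm (fun n => ?_) hlim
  refine (norm_sum_le _ _).trans ?_
  have hb : ∀ s ∈ Finset.range n,
      ‖gP x (n + 1) / gP x (s + 1) * x ^ ((s + 1) * (2 * (n + 1) + 1))‖ ≤
        A * B * ‖x‖ ^ n * ‖x‖ ^ s := by
    intro s _
    rw [div_eq_mul_inv, norm_mul, norm_mul, mul_assoc (A * B), ← pow_add, norm_pow]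
    refine mul_le_mul (mul_le_mul (hA' _) (hB' _) (norm_nonneg _) hA0) ?_ (by positivity)
      (by positivity)
    refine pow_le_pow_of_le_one (norm_nonneg _) hx.le ?_
    nlinarith
  refine (Finset.sum_le_sum hb).trans ?_
  rw [← Finset.mul_sum]
  exact mul_le_mul_of_nonneg_left (hg.sum_le_tsum _ (fun _ _ => by positivity)) (by positivity)

/-! ### Eta and theta -/

lemma qq_pow (k : ℕ) (τ : ℂ) : qq τ ^ k = qq (k * τ) := by
  unfold qq
  rw [← Complex.exp_nat_mul]
  ring_nf

lemma qq_norm {τ : ℂ} (hτ : 0 < τ.im) : ‖qq τ‖ < 1 := by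
  simpa [qq] using UpperHalfPlane.norm_exp_two_pi_I_lt_one ⟨τ, hτ⟩

lemma dedekindEta_eq (τ : ℂ) :
    dedekindEta τ = Complex.exp (Real.pi * Complex.I * τ / 12) * eul (qq τ) := rfl

lemma dedekindEta_eq_eta : dedekindEta = ModularForm.eta := by
  funext τ
  unfold dedekindEta ModularForm.eta
  congr 1
  · unfold Function.Periodic.qParam
    congr 1
    push_cast
    ring
  · refine tprod_congr fun n => ?_
    rw [ModularForm.eta_q_eq_pow]
    rfl

lemma dedekindEta_ne {τ : ℂ} (hτ : 0 < τ.im) : dedekindEta τ ≠ 0 := by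
  rw [dedekindEta_eq_eta]
  exact ModularForm.eta_ne_zero hτ

lemma E2_eq_EisE2 {τ : ℂ} (hτ : 0 < τ.im) :
    EisensteinSeries.E2 ⟨τ, hτ⟩ = EisE2 (qq τ) := by
  rw [EisensteinSeries.E2_eq_tsum_cexp, EisE2]
  congr 2
  rw [tsum_pnat_eq_tsum_succ (f := fun n : ℕ =>
    ((ArithmeticFunction.sigma 1 n : ℕ) : ℂ) * cexp (2 * Real.pi * I * τ) ^ n)]
  refine tsum_congr fun n => ?_
  simp [ArithmeticFunction.sigma_one_apply, qq]

lemma hasDerivAt_eta {τ : ℂ} (hτ : 0 < τ.im) :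
    HasDerivAt dedekindEta (2 * Real.pi * I * (EisE2 (qq τ) / 24) * dedekindEta τ) τ := by
  have h := ModularForm.logDeriv_eta_eq_E2 ⟨τ, hτ⟩
  have hd := (ModularForm.differentiableAt_eta_of_mem_upperHalfPlaneSet (z := τ) hτ).hasDerivAt
  rw [E2_eq_EisE2, logDeriv_apply, div_eq_iff (ModularForm.eta_ne_zero hτ)] at h
  rw [dedekindEta_eq_eta]
  have h' : deriv ModularForm.eta τ =
      2 * Real.pi * I * (EisE2 (qq τ) / 24) * ModularForm.eta τ :=
    Eq.trans h (by show _ * ModularForm.eta τ = _; ring)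
  rwa [h'] at hd

lemma hasDerivAt_eta_mul (k : ℕ) (hk : k ≠ 0) {τ : ℂ} (hτ : 0 < τ.im) :
    HasDerivAt (fun t => dedekindEta (k * t))
      (2 * Real.pi * I * (k * EisE2 (qq τ ^ k) / 24) * dedekindEta (k * τ)) τ := by
  have hk' : 0 < ((k : ℂ) * τ).im := by
    have : (0 : ℝ) < k := by positivity
    simp; positivity
  have h := (hasDerivAt_eta hk').comp τ ((hasDerivAt_id τ).const_mul (k : ℂ))
  rw [qq_pow]
  have e : 2 * Real.pi * I * (k * EisE2 (qq (k * τ)) / 24) * dedekindEta (k * τ) =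
      2 * Real.pi * I * (EisE2 (qq (k * τ)) / 24) * dedekindEta (k * τ) * (k * 1) := by ring
  rw [e]
  exact h

lemma theta2_eq {τ : ℂ} (hτ : 0 < τ.im) :
    theta2 τ = 2 * dedekindEta (4 * τ) ^ 2 / dedekindEta (2 * τ) := by
  have hq := qq_norm hτ
  have hx := norm_sq_lt hq (k := 2) (by norm_num)
  have hterm : ∀ m : ℕ, Complex.exp (2 * Real.pi * Complex.I * τ * ((m : ℂ) + 1 / 2) ^ 2) =
      Complex.exp (Real.pi * Complex.I * τ / 2) * (qq τ ^ 2) ^ (m * (m + 1) / 2) := by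
    intro m
    rw [← pow_mul, Nat.mul_div_cancel' (Nat.even_mul_succ_self m).two_dvd, qq_pow, qq,
      ← Complex.exp_add]
    congr 1
    push_cast
    ring
  have hs := (tri_summable hx).mul_left (Complex.exp (Real.pi * Complex.I * τ / 2))
  have hsum : HasSum (fun m : ℤ =>
      Complex.exp (2 * Real.pi * Complex.I * τ * ((m : ℂ) + 1 / 2) ^ 2))
      (Complex.exp (Real.pi * Complex.I * τ / 2) * (∑' s : ℕ, (qq τ ^ 2) ^ (s * (s + 1) / 2)) +
      Complex.exp (Real.pi * Complex.I * τ / 2) * (∑' s : ℕ, (qq τ ^ 2) ^ (s * (s + 1) / 2))) := by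
    have h0 := (tri_summable hx).hasSum.mul_left (Complex.exp (Real.pi * Complex.I * τ / 2))
    simp_rw [← hterm] at h0
    refine HasSum.of_nat_of_neg_add_one ?_ ?_
    · simpa using h0
    · convert h0 using 2 with m
      congr 1
      push_cast
      ring
  rw [theta2, hsum.tsum_eq, gauss_identity hx, dedekindEta_eq, dedekindEta_eq]
  have e4 : qq (4 * τ) = (qq τ ^ 2) ^ 2 := by rw [← pow_mul, qq_pow]; norm_num
  have e2 : qq (2 * τ) = qq τ ^ 2 := by rw [qq_pow]; norm_num
  rw [e4, e2]
  have hE := eul_ne hx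
  have hexp : Complex.exp (Real.pi * Complex.I * τ / 2) *
      Complex.exp (Real.pi * Complex.I * (2 * τ) / 12) =
      Complex.exp (Real.pi * Complex.I * (4 * τ) / 12) ^ 2 := by
    rw [← Complex.exp_nat_mul, ← Complex.exp_add]
    congr 1
    push_cast
    ring
  rw [eq_div_iff (mul_ne_zero (Complex.exp_ne_zero _) hE), mul_pow, ← hexp]
  field_simp
  ring

/-! ### Divisor sums -/

/-- `σ₁(n/k)` if `k ∣ n`, else `0` -/
def sdiv (k n : ℕ) : ℂ := if k ∣ n then ∑ d ∈ (n / k).divisors, (d : ℂ) else 0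

lemma sdiv_tsum {k : ℕ} (hk : k ≠ 0) {x : ℂ} (hx : ‖x‖ < 1) :
    HasSum (fun n : ℕ => sdiv k (n + 1) * x ^ (n + 1)) ((1 - EisE2 (x ^ k)) / 24) := by
  have hS : ∀ y : ℂ, ‖y‖ < 1 → Summable (fun n : ℕ => (∑ d ∈ n.divisors, (d : ℂ)) * y ^ n) := by
    intro y hy
    refine Summable.of_norm_bounded (g := fun n : ℕ => ‖(n : ℂ) ^ 2 * y ^ n‖)
      (summable_norm_pow_mul_geometric_of_norm_lt_one 2 hy) fun n => ?_
    rw [norm_mul, norm_mul]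
    refine mul_le_mul_of_nonneg_right ?_ (norm_nonneg _)
    refine (norm_sum_le _ _).trans ?_
    have : ∀ d ∈ n.divisors, ‖(d : ℂ)‖ ≤ n := fun d hd => by
      simpa using Nat.divisor_le hd
    refine (Finset.sum_le_card_nsmul _ _ _ this).trans ?_
    have := Nat.card_divisors_le_self n
    rw [nsmul_eq_mul, norm_pow, sq]
    simp only [Complex.norm_natCast]
    gcongr
  have h1 : HasSum (fun n : ℕ => (∑ d ∈ n.divisors, (d : ℂ)) * (x ^ k) ^ n)
      ((1 - EisE2 (x ^ k)) / 24) := by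
    have h := hS _ (norm_sq_lt hx hk)
    convert h.hasSum using 1
    rw [h.tsum_eq_zero_add, EisE2]
    simp
  have h2 : HasSum (fun n : ℕ => sdiv k n * x ^ n) ((1 - EisE2 (x ^ k)) / 24) := by
    have hinj : Function.Injective (fun n : ℕ => k * n) := fun a b h =>
      Nat.eq_of_mul_eq_mul_left (Nat.pos_of_ne_zero hk) h
    refine (hinj.hasSum_iff ?_).mp ?_
    · intro n hn
      have : ¬ k ∣ n := fun ⟨m, hm⟩ => hn ⟨m, hm.symm⟩
      simp [sdiv, this]
    · convert h1 using 2 with n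
      simp [sdiv, Nat.mul_div_cancel_left _ (Nat.pos_of_ne_zero hk), pow_mul]
  have h3 := (hasSum_nat_add_iff' (f := fun n : ℕ => sdiv k n * x ^ n) 1).mpr h2
  simpa [sdiv] using h3

lemma sum_dvd {k n : ℕ} (hk : k ≠ 0) (hn : n ≠ 0) :
    ∑ d ∈ n.divisors, (if k ∣ d then (d : ℂ) else 0) = k * sdiv k n := by
  unfold sdiv
  split_ifs with h
  · obtain ⟨m, rfl⟩ := h
    rw [Nat.mul_div_cancel_left _ (Nat.pos_of_ne_zero hk), ← Finset.sum_filter, Finset.mul_sum]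
    symm
    refine Finset.sum_bij (fun d _ => k * d) ?_ ?_ ?_ ?_
    · intro d hd
      simp only [Finset.mem_filter, Nat.mem_divisors] at hd ⊢
      exact ⟨⟨Nat.mul_dvd_mul_left k hd.1, hn⟩, dvd_mul_right _ _⟩
    · intro a _ b _ h
      exact Nat.eq_of_mul_eq_mul_left (Nat.pos_of_ne_zero hk) h
    · intro d hd
      simp only [Finset.mem_filter, Nat.mem_divisors] at hd
      obtain ⟨⟨h1, _⟩, e, rfl⟩ := hd
      refine ⟨e, ?_, rfl⟩
      rw [Nat.mem_divisors]
      exact ⟨Nat.dvd_of_mul_dvd_mul_left (Nat.pos_of_ne_zero hk) h1, fun h => hn (by simp [h])⟩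
    · intro d _
      push_cast
      rfl
  · rw [mul_zero]
    refine Finset.sum_eq_zero fun d hd => ?_
    rw [if_neg]
    exact fun h' => h (h'.trans (Nat.dvd_of_mem_divisors hd))

lemma sum_dvd_compl {k n : ℕ} (hk : k ≠ 0) (hn : n ≠ 0) :
    ∑ d ∈ n.divisors, (if k ∣ n / d then (d : ℂ) else 0) = sdiv k n := by
  unfold sdiv
  split_ifs with h
  · rw [← Finset.sum_filter]
    refine Finset.sum_congr ?_ fun _ _ => rfl
    ext d
    simp only [Finset.mem_filter, Nat.mem_divisors]
    obtain ⟨m, rfl⟩ := h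
    rw [Nat.mul_div_cancel_left _ (Nat.pos_of_ne_zero hk)]
    constructor
    · rintro ⟨⟨⟨e, he⟩, _⟩, hd⟩
      have hd0 : 0 < d := Nat.pos_of_ne_zero fun h => hn (by simp [he, h])
      rw [he, Nat.mul_div_cancel_left _ hd0] at hd
      obtain ⟨f, rfl⟩ := hd
      refine ⟨⟨f, ?_⟩, fun h => hn (by simp [h])⟩
      refine Nat.eq_of_mul_eq_mul_left (Nat.pos_of_ne_zero hk) ?_
      rw [he]; ring
    · rintro ⟨⟨f, rfl⟩, hm⟩
      have hd0 : 0 < d := Nat.pos_of_ne_zero fun h => hm (by simp [h])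
      refine ⟨⟨⟨k * f, by ring⟩, hn⟩, ?_⟩
      rw [show k * (d * f) = d * (k * f) by ring, Nat.mul_div_cancel_left _ hd0]
      exact dvd_mul_right _ _
  · refine Finset.sum_eq_zero fun d hd => ?_
    rw [if_neg]
    exact fun h' => h (h'.trans (Nat.div_dvd_of_dvd (Nat.dvd_of_mem_divisors hd)))

/-- If `χ(m mod N) = a[k ∣ m] + b[l ∣ m]`, then `σ₁(n; χ) = a k σ₁(n/k) + b l σ₁(n/l)`. -/
lemma wdiv_eq {N k l : ℕ} (hk : k ≠ 0) (hl : l ≠ 0) {χ : ℕ → ℂ} (a b : ℂ)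
    (h : ∀ m, χ (m % N) = a * (if k ∣ m then 1 else 0) + b * (if l ∣ m then 1 else 0)) (n : ℕ) :
    wdiv 1 N χ (n + 1) = a * k * sdiv k (n + 1) + b * l * sdiv l (n + 1) := by
  rw [mul_assoc, mul_assoc, ← sum_dvd hk n.succ_ne_zero, ← sum_dvd hl n.succ_ne_zero,
    Finset.mul_sum, Finset.mul_sum, ← Finset.sum_add_distrib, wdiv]
  refine Finset.sum_congr rfl fun d _ => ?_
  rw [h]
  split_ifs <;> ring

lemma wdivc_eq {N k l : ℕ} (hk : k ≠ 0) (hl : l ≠ 0) {χ : ℕ → ℂ} (a b : ℂ)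
    (h : ∀ m, χ (m % N) = a * (if k ∣ m then 1 else 0) + b * (if l ∣ m then 1 else 0)) (n : ℕ) :
    wdivc 1 N χ (n + 1) = a * sdiv k (n + 1) + b * sdiv l (n + 1) := by
  rw [← sum_dvd_compl hk n.succ_ne_zero, ← sum_dvd_compl hl n.succ_ne_zero,
    Finset.mul_sum, Finset.mul_sum, ← Finset.sum_add_distrib, wdivc]
  refine Finset.sum_congr rfl fun d _ => ?_
  rw [h]
  split_ifs <;> ring

lemma wdiv_tsum {N k l : ℕ} (hk : k ≠ 0) (hl : l ≠ 0) {χ : ℕ → ℂ} (a b : ℂ)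
    (h : ∀ m, χ (m % N) = a * (if k ∣ m then 1 else 0) + b * (if l ∣ m then 1 else 0))
    {x : ℂ} (hx : ‖x‖ < 1) :
    ∑' n : ℕ, wdiv 1 N χ (n + 1) * x ^ (n + 1) =
      a * k * ((1 - EisE2 (x ^ k)) / 24) + b * l * ((1 - EisE2 (x ^ l)) / 24) := by
  refine HasSum.tsum_eq ?_
  have h1 := ((sdiv_tsum hk hx).mul_left (a * k)).add ((sdiv_tsum hl hx).mul_left (b * l))
  refine Eq.mp (congrArg (fun f : ℕ → ℂ => HasSum f _) (funext fun n => ?_)) h1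
  rw [wdiv_eq hk hl a b h]
  ring

lemma wdivc_tsum {N k l : ℕ} (hk : k ≠ 0) (hl : l ≠ 0) {χ : ℕ → ℂ} (a b : ℂ)
    (h : ∀ m, χ (m % N) = a * (if k ∣ m then 1 else 0) + b * (if l ∣ m then 1 else 0))
    {x : ℂ} (hx : ‖x‖ < 1) :
    ∑' n : ℕ, wdivc 1 N χ (n + 1) * x ^ (n + 1) =
      a * ((1 - EisE2 (x ^ k)) / 24) + b * ((1 - EisE2 (x ^ l)) / 24) := by
  refine HasSum.tsum_eq ?_
  have h1 := ((sdiv_tsum hk hx).mul_left a).add ((sdiv_tsum hl hx).mul_left b)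
  refine Eq.mp (congrArg (fun f : ℕ → ℂ => HasSum f _) (funext fun n => ?_)) h1
  rw [wdivc_eq hk hl a b h]
  ring

/-! ### Logarithmic derivatives -/

/-- logarithmic derivative of an eta quotient -/
lemma eta_quot (c : ℂ) (hc : c ≠ 0) (k l a b : ℕ) (hk : k ≠ 0) (hl : l ≠ 0) {τ : ℂ}
    (hτ : 0 < τ.im) (f : ℂ → ℂ)
    (hf : ∀ t : ℂ, 0 < t.im → f t = c * dedekindEta (k * t) ^ a / dedekindEta (l * t) ^ b) :
    dq f τ / f τ = (a * k * EisE2 (qq τ ^ k) - b * l * EisE2 (qq τ ^ l)) / 24 := by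
  have him : ∀ m : ℕ, m ≠ 0 → 0 < ((m : ℂ) * τ).im := fun m hm => by
    have : (0 : ℝ) < m := by positivity
    simp; positivity
  have nk := dedekindEta_ne (him k hk)
  have nl := dedekindEta_ne (him l hl)
  have hev : f =ᶠ[nhds τ] fun t => c * dedekindEta (k * t) ^ a / dedekindEta (l * t) ^ b := by
    filter_upwards [(isOpen_lt continuous_const Complex.continuous_im).mem_nhds hτ] with t ht
    exact hf t ht
  have hpi : (2 * Real.pi * I : ℂ) ≠ 0 := Complex.two_pi_I_ne_zero
  have hlog : logDeriv f τ = 2 * Real.pi * I *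
      ((a * k * EisE2 (qq τ ^ k) - b * l * EisE2 (qq τ ^ l)) / 24) := by
    have dk := hasDerivAt_eta_mul k hk hτ
    have dl := hasDerivAt_eta_mul l hl hτ
    have lk : logDeriv (fun t => dedekindEta (k * t)) τ =
        2 * Real.pi * I * (k * EisE2 (qq τ ^ k) / 24) := by
      rw [logDeriv_apply, dk.deriv, mul_div_cancel_right₀ _ nk]
    have ll : logDeriv (fun t => dedekindEta (l * t)) τ =
        2 * Real.pi * I * (l * EisE2 (qq τ ^ l) / 24) := by
      rw [logDeriv_apply, dl.deriv, mul_div_cancel_right₀ _ nl]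
    have e1 : logDeriv f τ = logDeriv
        (fun t => c * dedekindEta (k * t) ^ a / dedekindEta (l * t) ^ b) τ := by
      rw [logDeriv_apply, logDeriv_apply, hev.deriv_eq, hev.eq_of_nhds]
    rw [e1, logDeriv_div (f := fun t => c * dedekindEta (k * t) ^ a)
        (g := fun t => dedekindEta (l * t) ^ b) τ
        (mul_ne_zero hc (pow_ne_zero _ nk)) (pow_ne_zero _ nl)
        ((dk.differentiableAt.fun_pow a).const_mul c) (dl.differentiableAt.fun_pow b),
      logDeriv_const_mul τ c hc,
      logDeriv_fun_pow dk.differentiableAt, logDeriv_fun_pow dl.differentiableAt, lk, ll]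
    ring
  rw [logDeriv_apply] at hlog
  rw [dq, mul_div_assoc, hlog, inv_mul_cancel_left₀ hpi]

lemma E4sig_eq {τ : ℂ} (hτ : 0 < τ.im) :
    E4sig τ = (1 / 3) * (4 * EisE2 (qq τ ^ 2) - EisE2 (qq τ)) := by
  have := eta_quot 64 (by norm_num) 2 1 16 8 (by norm_num) (by norm_num) hτ C44
    (fun t _ => by simp [C44])
  rw [E4sig, this]
  push_cast
  rw [pow_one]
  ring

lemma E3sig_eq {τ : ℂ} (hτ : 0 < τ.im) :
    E3sig τ = (1 / 8) * (9 * EisE2 (qq τ ^ 3) - EisE2 (qq τ)) := by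
  have := eta_quot 27 (by norm_num) 3 1 9 3 (by norm_num) (by norm_num) hτ (fun t => C3 t ^ 3)
    (fun t _ => by simp only [C3]; push_cast; rw [div_pow, one_mul]; ring)
  rw [E3sig, this]
  push_cast
  rw [pow_one]
  ring

lemma E2sig_eq {τ : ℂ} (hτ : 0 < τ.im) :
    E2sig τ = (1 / 3) * (4 * EisE2 (qq τ ^ 4) - EisE2 (qq τ ^ 2)) := by
  have := eta_quot 16 (by norm_num) 4 2 8 4 (by norm_num) (by norm_num) hτ (fun t => theta2 t ^ 4)
    (fun t ht => by simp only [theta2_eq ht]; push_cast; rw [div_pow]; ring)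
  rw [E2sig, this]
  push_cast
  ring

theorem quasimodular_eisenstein_representations (τ : ℂ) (hτ : 0 < τ.im) :
    (E4sig τ = (1 / 3) * (4 * EisE2 (qq τ ^ 2) - EisE2 (qq τ)) ∧
      E4sig τ = 1 + 8 * ∑' n : ℕ,
        wdiv 1 2 (fun m => if m = 0 then -1 else 1) (n + 1) * qq τ ^ (n + 1) ∧
      E4sig τ = 1 + 8 * ∑' n : ℕ,
        wdivc 1 2 (fun m => if m = 0 then -3 else 1) (n + 1) * qq τ ^ (n + 1)) ∧
    (E3sig τ = (1 / 8) * (9 * EisE2 (qq τ ^ 3) - EisE2 (qq τ)) ∧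
      E3sig τ = 1 + 3 * ∑' n : ℕ,
        wdiv 1 3 (fun m => if m = 0 then -2 else 1) (n + 1) * qq τ ^ (n + 1) ∧
      E3sig τ = 1 + 3 * ∑' n : ℕ,
        wdivc 1 3 (fun m => if m = 0 then -8 else 1) (n + 1) * qq τ ^ (n + 1)) ∧
    (E2sig τ = (1 / 3) * (4 * EisE2 (qq τ ^ 4) - EisE2 (qq τ ^ 2)) ∧
      E2sig τ = 1 + 4 * ∑' n : ℕ,
        wdiv 1 4 (fun m => if m = 0 then -1 else if m = 2 then 1 else 0) (n + 1) *
          qq τ ^ (n + 1) ∧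
      E2sig τ = 1 + 8 * ∑' n : ℕ,
        wdivc 1 4 (fun m => if m = 0 then -3 else if m = 2 then 1 else 0) (n + 1) *
          qq τ ^ (n + 1)) ∧
    E2sig τ = E4sig (2 * τ) := by
  have hq := qq_norm hτ
  have h2τ : 0 < (2 * τ).im := by simpa using hτ
  have hx2 : ∀ (c : ℂ) (m : ℕ), (fun m : ℕ => if m = 0 then 1 + c else (1 : ℂ)) (m % 2) =
      1 * (if 1 ∣ m then 1 else 0) + c * (if 2 ∣ m then 1 else 0) := by
    intro c m
    have hk : 2 ∣ m ↔ m % 2 = 0 := by omega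
    simp only [hk, one_dvd]
    split_ifs <;> simp
  have hx3 : ∀ (c : ℂ) (m : ℕ), (fun m : ℕ => if m = 0 then 1 + c else (1 : ℂ)) (m % 3) =
      1 * (if 1 ∣ m then 1 else 0) + c * (if 3 ∣ m then 1 else 0) := by
    intro c m
    have hk : 3 ∣ m ↔ m % 3 = 0 := by omega
    simp only [hk, one_dvd]
    split_ifs <;> simp
  have hx4 : ∀ (c : ℂ) (m : ℕ),
      (fun m : ℕ => if m = 0 then 1 + c else if m = 2 then 1 else (0 : ℂ)) (m % 4) =
      1 * (if 2 ∣ m then 1 else 0) + c * (if 4 ∣ m then 1 else 0) := by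
    intro c m
    have h4 : 4 ∣ m ↔ m % 4 = 0 := by omega
    have h2 : 2 ∣ m ↔ (m % 4 = 0 ∨ m % 4 = 2) := by omega
    simp only [h4, h2]
    by_cases a : m % 4 = 0
    · simp [a]
    · by_cases b : m % 4 = 2
      · simp [b]
      · simp [a, b]
  have w2 := wdiv_tsum (N := 2) one_ne_zero two_ne_zero
    (χ := fun m => if m = 0 then 1 + (-2) else 1) 1 (-2) (hx2 (-2)) hq
  have c2 := wdivc_tsum (N := 2) one_ne_zero two_ne_zero
    (χ := fun m => if m = 0 then 1 + (-4) else 1) 1 (-4) (hx2 (-4)) hq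
  have w3 := wdiv_tsum (N := 3) one_ne_zero three_ne_zero
    (χ := fun m => if m = 0 then 1 + (-3) else 1) 1 (-3) (hx3 (-3)) hq
  have c3 := wdivc_tsum (N := 3) one_ne_zero three_ne_zero
    (χ := fun m => if m = 0 then 1 + (-9) else 1) 1 (-9) (hx3 (-9)) hq
  have w4 := wdiv_tsum (N := 4) two_ne_zero four_ne_zero
    (χ := fun m => if m = 0 then 1 + (-2) else if m = 2 then 1 else 0) 1 (-2) (hx4 (-2)) hq
  have c4 := wdivc_tsum (N := 4) two_ne_zero four_ne_zero
    (χ := fun m => if m = 0 then 1 + (-4) else if m = 2 then 1 else 0) 1 (-4) (hx4 (-4)) hq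
  norm_num only [pow_one] at w2 c2 w3 c3 w4 c4
  refine ⟨⟨E4sig_eq hτ, ?_, ?_⟩, ⟨E3sig_eq hτ, ?_, ?_⟩, ⟨E2sig_eq hτ, ?_, ?_⟩, ?_⟩
  · rw [E4sig_eq hτ, w2]; ring
  · rw [E4sig_eq hτ, c2]; ring
  · rw [E3sig_eq hτ, w3]; ring
  · rw [E3sig_eq hτ, c3]; ring
  · rw [E2sig_eq hτ, w4]; ring
  · rw [E2sig_eq hτ, c4]; ring
  · rw [E2sig_eq hτ, E4sig_eq h2τ]
    have e2 : qq (2 * τ) = qq τ ^ 2 := by rw [qq_pow]; norm_num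
    rw [e2, ← pow_mul]
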